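/- arXiv:0911.2056 — 4 statements merged into one kernel-verified Lean document; each statement's English description precedes it below -/
import Mathlib

section
/- Let E and ′E be two first-quadrant cohomological spectral sequences (of abelian groups, or of vector spaces over a field) starting at page 2. Suppose that for every s ≠ 0 and all r ≥ 2, t, the differential ′E_r^{st} → ′E_r^{s+r,t−(r−1)} is zero. Suppose further that φ : E → ′E is a morphism of spectral sequences such that for all r ≥ 2 and all s,t, the induced composite map E_r^{st} → ′E_r^{st} → ′E_r^{s+r,t−(r−1)} given by following φ with the differential of ′E (equivalently, the differential of E followed by φ) is zero, and such that φ_2^{st} : E_2^{st} → ′E_2^{st} is injective for all s,t. Then E degenerates: for all r ≥ 2 and all s,t, every differential into and out of E_r^{st} is zero. -/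
/-!
STATEMENT 2: Let `E` and `′E` be first-quadrant cohomological spectral sequences (here,
of vector spaces over a field `K`) starting at page `2`, and `φ : E → ′E` a morphism of
spectral sequences.  If every differential of `′E` out of a term in a column `s ≠ 0`
vanishes, if the composite of `φ` with the differentials of `′E` vanishes, and if `φ` is
injective on the second page, then `E` degenerates: all differentials into and out of
every term of every page vanish.

In the structures below, the index `r : ℕ` of `E r s t` refers to the page numbered
`2 + r` (so `r = 0` is the starting page `E_2`).  The differentials are encoded as a
family `d r s t s' t' : E r s t →ₗ[K] E r s' t'` for *all* source and target bidegrees,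
required to vanish unless `(s', t') = (s + (2+r), t - (2+r) + 1)`.
-/

universe u

/-- A first-quadrant cohomological spectral sequence of `K`-vector spaces starting at
page `r₀`.  `E r s t` is the term of bidegree `(s, t)` on the page numbered `r₀ + r`. -/
structure FirstQuadrantSpectralSeq (K : Type u) [Field K] (r₀ : ℕ) where
  /-- the terms of the spectral sequence -/
  E : ℕ → ℤ → ℤ → Type u
  /-- each term is an abelian group -/
  [instAdd : ∀ r s t, AddCommGroup (E r s t)]
  /-- each term is a `K`-vector space -/
  [instMod : ∀ r s t, Module K (E r s t)]
  /-- first quadrant: terms vanish if `s < 0` or `t < 0` -/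
  firstQuadrant : ∀ r s t, s < 0 ∨ t < 0 → Subsingleton (E r s t)
  /-- the differentials (all of them zero except those of bidegree `(r₀+r, -(r₀+r)+1)`) -/
  d : ∀ (r : ℕ) (s t s' t' : ℤ), E r s t →ₗ[K] E r s' t'
  /-- differentials vanish except in the proper bidegree -/
  d_eq_zero : ∀ (r : ℕ) (s t s' t' : ℤ),
    ¬(s' = s + (r₀ + r : ℕ) ∧ t' = t - (r₀ + r : ℕ) + 1) → d r s t s' t' = 0
  /-- `d ∘ d = 0` -/
  d_comp_d : ∀ (r : ℕ) (s t s' t' s'' t'' : ℤ),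
    (d r s' t' s'' t'').comp (d r s t s' t') = 0
  /-- each page is the homology of the previous one: `E_{r+1}^{st} ≅ ker d ⧸ im d` -/
  pageIso : ∀ (r : ℕ) (s t : ℤ),
    E (r + 1) s t ≃ₗ[K]
      (LinearMap.ker (d r s t (s + (r₀ + r : ℕ)) (t - (r₀ + r : ℕ) + 1)) ⧸
        Submodule.comap
          (LinearMap.ker (d r s t (s + (r₀ + r : ℕ)) (t - (r₀ + r : ℕ) + 1))).subtype
          (LinearMap.range (d r (s - (r₀ + r : ℕ)) (t + (r₀ + r : ℕ) - 1) s t)))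

attribute [instance] FirstQuadrantSpectralSeq.instAdd FirstQuadrantSpectralSeq.instMod


namespace FirstQuadrantSpectralSeq

variable {K : Type u} [Field K] {r₀ : ℕ}

/-- The map induced on the homology `ker d ⧸ im d` of the pages by a collection of maps
`φ` commuting with the differentials. -/
noncomputable def inducedMap (A B : FirstQuadrantSpectralSeq K r₀)
    (φ : ∀ (r : ℕ) (s t : ℤ), A.E r s t →ₗ[K] B.E r s t)
    (comm : ∀ (r : ℕ) (s t s' t' : ℤ),
      (B.d r s t s' t').comp (φ r s t) = (φ r s' t').comp (A.d r s t s' t'))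
    (r : ℕ) (s t : ℤ) :
    (LinearMap.ker (A.d r s t (s + (r₀ + r : ℕ)) (t - (r₀ + r : ℕ) + 1)) ⧸
        Submodule.comap
          (LinearMap.ker (A.d r s t (s + (r₀ + r : ℕ)) (t - (r₀ + r : ℕ) + 1))).subtype
          (LinearMap.range (A.d r (s - (r₀ + r : ℕ)) (t + (r₀ + r : ℕ) - 1) s t))) →ₗ[K]
    (LinearMap.ker (B.d r s t (s + (r₀ + r : ℕ)) (t - (r₀ + r : ℕ) + 1)) ⧸
        Submodule.comap
          (LinearMap.ker (B.d r s t (s + (r₀ + r : ℕ)) (t - (r₀ + r : ℕ) + 1))).subtype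
          (LinearMap.range (B.d r (s - (r₀ + r : ℕ)) (t + (r₀ + r : ℕ) - 1) s t))) :=
  Submodule.mapQ _ _
    ((φ r s t).restrict (p := LinearMap.ker (A.d r s t _ _))
      (q := LinearMap.ker (B.d r s t (s + (r₀ + r : ℕ)) (t - (r₀ + r : ℕ) + 1)))
      (fun x hx => by
        have h := congrFun (congrArg (DFunLike.coe)
          (comm r s t (s + (r₀ + r : ℕ)) (t - (r₀ + r : ℕ) + 1))) x
        simp only [LinearMap.coe_comp, Function.comp_apply] at h
        simp only [LinearMap.mem_ker] at hx ⊢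
        rw [h, hx, map_zero]))
    (by
      intro x hx
      simp only [Submodule.mem_comap, Submodule.coe_subtype, LinearMap.mem_range] at hx ⊢
      obtain ⟨y, hy⟩ := hx
      refine ⟨φ r (s - (r₀ + r : ℕ)) (t + (r₀ + r : ℕ) - 1) y, ?_⟩
      have h := congrFun (congrArg (DFunLike.coe)
        (comm r (s - (r₀ + r : ℕ)) (t + (r₀ + r : ℕ) - 1) s t)) y
      simp only [LinearMap.coe_comp, Function.comp_apply] at h
      rw [h, hy]
      rfl)

/-- A morphism of first-quadrant spectral sequences: a collection of maps commuting with
the differentials and compatible with the identifications of each page as the homology of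
the previous one. -/
structure Hom (A B : FirstQuadrantSpectralSeq K r₀) where
  /-- the components of the morphism -/
  φ : ∀ (r : ℕ) (s t : ℤ), A.E r s t →ₗ[K] B.E r s t
  /-- compatibility with the differentials -/
  comm : ∀ (r : ℕ) (s t s' t' : ℤ),
    (B.d r s t s' t').comp (φ r s t) = (φ r s' t').comp (A.d r s t s' t')
  /-- compatibility with the identifications of `E_{r+1}` as the homology of
  `(E_r, d_r)`: under `pageIso`, `φ (r+1)` is the map induced by `φ r` on homology. -/
  compat : ∀ (r : ℕ) (s t : ℤ),
    (B.pageIso r s t).toLinearMap.comp (φ (r + 1) s t)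
      = (inducedMap A B φ comm r s t).comp (A.pageIso r s t).toLinearMap

end FirstQuadrantSpectralSeq

namespace FirstQuadrantSpectralSeq

variable {K : Type u} [Field K] {r₀ : ℕ}

/-- If no differential of the target enters the bidegree `(s, t)` on a page, then injectivity of
a morphism at `(s, t)` passes to the next page. -/
theorem Hom.injective_succ {A B : FirstQuadrantSpectralSeq K r₀} (f : Hom A B)
    {r : ℕ} {s t : ℤ} (hd : B.d r (s - (r₀ + r : ℕ)) (t + (r₀ + r : ℕ) - 1) s t = 0)
    (hinj : Function.Injective (f.φ r s t)) :
    Function.Injective (f.φ (r + 1) s t) := by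
  rw [injective_iff_map_eq_zero]
  intro x hx
  have h := LinearMap.congr_fun (f.compat r s t) x
  simp only [LinearMap.comp_apply, hx, map_zero, LinearEquiv.coe_coe] at h
  rw [← (A.pageIso r s t).map_eq_zero_iff]
  obtain ⟨y, hy⟩ := Submodule.Quotient.mk_surjective _ (A.pageIso r s t x)
  rw [← hy] at h ⊢
  have h' := (Submodule.Quotient.mk_eq_zero _).1 h.symm
  rw [hd, LinearMap.range_zero] at h'
  have hy0 : f.φ r s t y = 0 := h'
  have : y = 0 := Subtype.ext (hinj (hy0.trans (map_zero _).symm))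
  rw [this, Submodule.Quotient.mk_zero]

/-- If every differential of the target out of a column `s ≠ 0` vanishes and a morphism is
injective on the first page, then on each page it is injective in every column that a
differential from the first quadrant can reach. -/
theorem Hom.injective_of_le {A B : FirstQuadrantSpectralSeq K r₀} (f : Hom A B)
    (hB : ∀ (r : ℕ) (s t s' t' : ℤ), s ≠ 0 → B.d r s t s' t' = 0)
    (hinj : ∀ s t : ℤ, Function.Injective (f.φ 0 s t)) (r : ℕ) {s : ℤ} (t : ℤ)
    (hs : (r₀ + r : ℕ) ≤ s) : Function.Injective (f.φ r s t) := by
  induction r with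
  | zero => exact hinj s t
  | succ r ih => exact f.injective_succ (hB _ _ _ _ _ (by lia)) (ih (by lia))

/-- A differential vanishes if its composite with a morphism does and the morphism is injective
in every column that a differential from the first quadrant can reach. -/
theorem Hom.d_eq_zero_of_comp_eq_zero {A B : FirstQuadrantSpectralSeq K r₀} (f : Hom A B)
    {r : ℕ} {s t s' t' : ℤ}
    (hinj : (r₀ + r : ℕ) ≤ s' → Function.Injective (f.φ r s' t'))
    (h : (B.d r s t s' t').comp (f.φ r s t) = 0) : A.d r s t s' t' = 0 := by
  by_cases hdeg : s' = s + (r₀ + r : ℕ) ∧ t' = t - (r₀ + r : ℕ) + 1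
  · rcases lt_or_ge s 0 with hs | hs
    · have := A.firstQuadrant r s t (Or.inl hs)
      exact Subsingleton.elim _ _
    · rw [f.comm] at h
      ext x
      apply hinj (by lia)
      simpa using LinearMap.congr_fun h x
  · exact A.d_eq_zero _ _ _ _ _ hdeg

end FirstQuadrantSpectralSeq

open FirstQuadrantSpectralSeq in
theorem spectral_sequence_degenerates_of_hom
    {K : Type} [Field K] (A B : FirstQuadrantSpectralSeq K 2)
    (φ : FirstQuadrantSpectralSeq.Hom A B)
    -- every differential of `′E` out of a column `s ≠ 0` is zero
    (hB : ∀ (r : ℕ) (s t s' t' : ℤ), s ≠ 0 → B.d r s t s' t' = 0)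
    -- the composite `E_r^{st} → ′E_r^{st} → ′E_r^{s+r, t-(r-1)}` is zero
    (hφd : ∀ (r : ℕ) (s t s' t' : ℤ), (B.d r s t s' t').comp (φ.φ r s t) = 0)
    -- `φ` is injective on the second page
    (hinj : ∀ s t : ℤ, Function.Injective (φ.φ 0 s t)) :
    -- `E` degenerates: every differential into and out of every `E_r^{st}` is zero
    ∀ (r : ℕ) (s t : ℤ),
      (∀ s' t' : ℤ, A.d r s t s' t' = 0) ∧ (∀ s' t' : ℤ, A.d r s' t' s t = 0) := by
  have hd : ∀ (r : ℕ) (s t s' t' : ℤ), A.d r s t s' t' = 0 := fun r s t s' t' =>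
    φ.d_eq_zero_of_comp_eq_zero (φ.injective_of_le hB hinj r t') (hφd r s t s' t')
  exact fun r s t => ⟨fun s' t' => hd r s t s' t', fun s' t' => hd r s' t' s t⟩
end

section
/- Let E and ′E be two first-quadrant cohomological spectral sequences starting at page 2, and let φ : E → ′E be a morphism of spectral sequences. Suppose that for every s ≠ 0 and all r ≥ 2, t, the differential ′E_r^{st} → ′E_r^{s+r,t−(r−1)} is zero; that for all r ≥ 2 and all s,t the composite E_r^{st} → ′E_r^{st} → ′E_r^{s+r,t−(r−1)} (φ followed by the differential of ′E) is zero; and that φ_2^{st} : E_2^{st} → ′E_2^{st} is injective for all s,t. Then for every r ≥ 2 and every s ≥ r and every t, the map φ_r^{st} : E_r^{st} → ′E_r^{st} is injective. -/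
/-!
STATEMENT 3: Let `E` and `′E` be first-quadrant cohomological spectral sequences (here,
of vector spaces over a field `K`) starting at page `2`, and `φ : E → ′E` a morphism of
spectral sequences.  If every differential of `′E` out of a term in a column `s ≠ 0`
vanishes, if the composite of `φ` with the differentials of `′E` vanishes, and if `φ` is
injective on the second page, then for every `r ≥ 2` and every `s ≥ r` the map
`φ_r^{st} : E_r^{st} → ′E_r^{st}` is injective.

In the structures below, the index `r : ℕ` of `E r s t` refers to the page numbered
`2 + r` (so `r = 0` is the starting page `E_2`, and `s ≥ page number` reads
`(r : ℤ) + 2 ≤ s`).  The differentials are encoded as a family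
`d r s t s' t' : E r s t →ₗ[K] E r s' t'` for *all* source and target bidegrees,
required to vanish unless `(s', t') = (s + (2+r), t - (2+r) + 1)`.
-/

universe u

open FirstQuadrantSpectralSeq in
theorem spectral_sequence_hom_injective_on_late_columns
    {K : Type} [Field K] (A B : FirstQuadrantSpectralSeq K 2)
    (φ : FirstQuadrantSpectralSeq.Hom A B)
    -- every differential of `′E` out of a column `s ≠ 0` is zero
    (hB : ∀ (r : ℕ) (s t s' t' : ℤ), s ≠ 0 → B.d r s t s' t' = 0)
    -- the composite `E_r^{st} → ′E_r^{st} → ′E_r^{s+r, t-(r-1)}` is zero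
    (hφd : ∀ (r : ℕ) (s t s' t' : ℤ), (B.d r s t s' t').comp (φ.φ r s t) = 0)
    -- `φ` is injective on the second page
    (hinj : ∀ s t : ℤ, Function.Injective (φ.φ 0 s t)) :
    -- `φ_r^{st}` is injective whenever `s` is at least the page number `r + 2`
    ∀ (r : ℕ) (s t : ℤ), (r : ℤ) + 2 ≤ s → Function.Injective (φ.φ r s t) := by
  intro r
  induction r with
  | zero => exact fun s t _ => hinj s t
  | succ r ih =>
    intro s t hs
    rw [injective_iff_map_eq_zero]
    intro x hx
    have hc := LinearMap.congr_fun (φ.compat r s t) x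
    simp only [LinearMap.coe_comp, Function.comp_apply, hx, map_zero] at hc
    rw [← (A.pageIso r s t).map_eq_zero_iff]
    obtain ⟨z, hz⟩ := Submodule.Quotient.mk_surjective _ (A.pageIso r s t x)
    rw [LinearEquiv.coe_coe, ← hz] at hc
    obtain ⟨y, hy⟩ := (Submodule.Quotient.mk_eq_zero _).mp hc.symm
    have hd := hB r (s - (2 + r : ℕ)) (t + (2 + r : ℕ) - 1) s t (by push_cast at hs ⊢; omega)
    rw [hd, LinearMap.zero_apply] at hy
    have hz₀ : z = 0 := Subtype.ext <|
      (injective_iff_map_eq_zero _).mp (ih s t (by push_cast at hs; omega)) z.1 hy.symm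
    rw [← hz, hz₀, Submodule.Quotient.mk_zero]
end

section
/- Let X be a normal integral locally Noetherian scheme and let i : U ↪ X be an open immersion whose closed complement has codimension at least 2 in X. If ℱ is a reflexive coherent sheaf of O_X-modules (that is, the canonical map from ℱ to its double dual ℱ^∨∨ = Hom_{O_X}(Hom_{O_X}(ℱ, O_X), O_X) is an isomorphism), then the adjunction map ℱ → i_* i^* ℱ is an isomorphism of O_X-modules. -/
/-!
STATEMENT 4: Let `X` be a normal integral locally Noetherian scheme and `i : U ↪ X` an
open immersion whose closed complement has codimension at least 2.  If `ℱ` is a reflexive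
coherent sheaf of `O_X`-modules, then the adjunction unit `ℱ → i_* i^* ℱ` is an
isomorphism of `O_X`-modules.

Since Mathlib has no sheaf-Hom of sheaves of modules, we develop the needed notions
concretely.  A (pre)sheaf of `O_X`-modules is given by its sections: an
`O_X(V)`-module `ℱ(V)` for each open `V`, with additive restriction maps that are
semilinear with respect to restriction of scalars (`OModulePresheaf`, with the sheaf
condition as the predicate `IsSheafOfOModules`).  The sections over `U` of the sheaf-Hom
`Hom_{O_X}(ℱ, 𝒢)` are, as usual, the compatible families of `O_X(V)`-linear maps
`ℱ(V) → 𝒢(V)` for `V ≤ U` (`HomSections`, giving the hom sheaf `homOMod` and the dual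
`ℱ^∨ = homOMod ℱ O_X`).  `ℱ` is *reflexive* if the canonical evaluation map
`ℱ → ℱ^∨∨` is an isomorphism (componentwise bijective, `IsReflexive`), and *coherent*
(= finitely presented, `X` being locally Noetherian) if, locally on `X`, there is an
exact sequence `O_X^m → O_X^n → ℱ → 0` of sheaves, exactness being imposed locally
(`IsCoherentOMod`).  For the open immersion `i` of the open set `U₀`, the sheaf
`i_* i^* ℱ` has sections `V ↦ ℱ(V ⊓ U₀)` and the adjunction unit is the restriction
`ℱ(V) → ℱ(V ⊓ U₀)`; it is an isomorphism of sheaves of `O_X`-modules iff all these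
restriction maps are bijective.  The codimension condition is that every point of the
complement of `U₀` has local ring of Krull dimension at least 2, and normality of the
integral scheme `X` is rendered as: every stalk of `O_X` is integrally closed.
-/

open AlgebraicGeometry CategoryTheory TopologicalSpace Opposite

universe u

/-- A presheaf of `O_X`-modules on a scheme `X`, given concretely by its sections. -/
structure OModulePresheaf (X : Scheme.{u}) where
  /-- the sections over each open subset -/
  obj : X.Opens → Type u
  /-- the sections form an abelian group -/
  [instAdd : ∀ U, AddCommGroup (obj U)]
  /-- the sections over `U` form a module over `O_X(U)` -/
  [instMod : ∀ U, Module (X.presheaf.obj (op U)) (obj U)]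
  /-- restriction of sections -/
  res : ∀ {U V : X.Opens}, V ≤ U → (obj U →+ obj V)
  res_id : ∀ (U : X.Opens) (x : obj U), res (le_refl U) x = x
  res_comp : ∀ {U V W : X.Opens} (hWV : W ≤ V) (hVU : V ≤ U) (x : obj U),
    res hWV (res hVU x) = res (hWV.trans hVU) x
  /-- restriction is semilinear with respect to restriction of scalars -/
  res_smul : ∀ {U V : X.Opens} (h : V ≤ U) (r : X.presheaf.obj (op U)) (x : obj U),
    res h (r • x) = (X.presheaf.map (homOfLE h).op r) • res h x

attribute [instance] OModulePresheaf.instAdd OModulePresheaf.instMod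

namespace OModulePresheaf

variable {X : Scheme.{u}}

/-- The sheaf condition (locality and gluing) for a presheaf of `O_X`-modules. -/
def IsSheafOfOModules (F : OModulePresheaf X) : Prop :=
  (∀ {ι : Type u} (Us : ι → X.Opens) (s t : F.obj (iSup Us)),
    (∀ i, F.res (le_iSup Us i) s = F.res (le_iSup Us i) t) → s = t) ∧
  (∀ {ι : Type u} (Us : ι → X.Opens) (sec : ∀ i, F.obj (Us i)),
    (∀ i j, F.res (inf_le_left : Us i ⊓ Us j ≤ Us i) (sec i)
      = F.res (inf_le_right : Us i ⊓ Us j ≤ Us j) (sec j)) →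
    ∃ s : F.obj (iSup Us), ∀ i, F.res (le_iSup Us i) s = sec i)

/-- Restricting a section of the structure sheaf in two steps. -/
private lemma res_res {U V W : X.Opens}
    (r : X.presheaf.obj (op U)) (hVU : V ≤ U) (hWV : W ≤ V) :
    X.presheaf.map (homOfLE hWV).op (X.presheaf.map (homOfLE hVU).op r)
      = X.presheaf.map (homOfLE (hWV.trans hVU)).op r := by
  rw [← CategoryTheory.comp_apply, ← Functor.map_comp]
  rfl

/-- The structure sheaf `O_X` as a presheaf of `O_X`-modules. -/
def structureOMod (X : Scheme.{u}) : OModulePresheaf X where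
  obj U := X.presheaf.obj (op U)
  instAdd U := inferInstance
  instMod U := inferInstance
  res h := AddMonoidHom.mk' (fun r => X.presheaf.map (homOfLE h).op r) (by simp)
  res_id U x := by simp
  res_comp hWV hVU x := by
    simp only [AddMonoidHom.mk'_apply]
    rw [← CategoryTheory.comp_apply, ← Functor.map_comp]; rfl
  res_smul h r x := by simp [smul_eq_mul, map_mul]

/-- The free presheaf of `O_X`-modules `O_X^n`. -/
def freeOMod (X : Scheme.{u}) (n : ℕ) : OModulePresheaf X where
  obj U := Fin n → X.presheaf.obj (op U)
  instAdd U := inferInstance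
  instMod U := inferInstance
  res h := AddMonoidHom.mk' (fun v i => X.presheaf.map (homOfLE h).op (v i))
    (by intro v w; funext i; simp)
  res_id U x := by funext i; simp
  res_comp hWV hVU x := by
    funext i
    simp only [AddMonoidHom.mk'_apply]
    rw [← CategoryTheory.comp_apply, ← Functor.map_comp]; rfl
  res_smul h r x := by funext i; simp [smul_eq_mul, map_mul]

variable (F G : OModulePresheaf X)

/-- The sections over `U` of the sheaf-Hom `Hom_{O_X}(F, G)`: compatible families of
`O_X(V)`-linear maps `F(V) → G(V)` for all opens `V ≤ U`. -/
@[ext]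
structure HomSections (U : X.Opens) where
  /-- the component over each open `V ≤ U` -/
  app : ∀ (V : X.Opens), V ≤ U → (F.obj V →ₗ[X.presheaf.obj (op V)] G.obj V)
  naturality : ∀ (V W : X.Opens) (hWV : W ≤ V) (hVU : V ≤ U) (x : F.obj V),
    G.res hWV (app V hVU x) = app W (hWV.trans hVU) (F.res hWV x)

namespace HomSections

variable {F G} {U : X.Opens}

instance : Zero (HomSections F G U) :=
  ⟨⟨fun _ _ => 0, by intros; simp⟩⟩

instance : Add (HomSections F G U) :=
  ⟨fun φ ψ => ⟨fun V h => φ.app V h + ψ.app V h, by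
    intro V W hWV hVU x
    simp [φ.naturality, ψ.naturality]⟩⟩

instance : Neg (HomSections F G U) :=
  ⟨fun φ => ⟨fun V h => -φ.app V h, by
    intro V W hWV hVU x
    simp [φ.naturality]⟩⟩

instance : Sub (HomSections F G U) :=
  ⟨fun φ ψ => ⟨fun V h => φ.app V h - ψ.app V h, by
    intro V W hWV hVU x
    simp [φ.naturality, ψ.naturality]⟩⟩

instance : SMul ℕ (HomSections F G U) :=
  ⟨fun n φ => ⟨fun V h => n • φ.app V h, by
    intro V W hWV hVU x
    simp [φ.naturality]⟩⟩

instance : SMul ℤ (HomSections F G U) :=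
  ⟨fun n φ => ⟨fun V h => n • φ.app V h, by
    intro V W hWV hVU x
    simp [φ.naturality]⟩⟩

instance : AddCommGroup (HomSections F G U) :=
  Function.Injective.addCommGroup
    (fun (φ : HomSections F G U) (V : {V : X.Opens // V ≤ U}) => φ.app V.1 V.2)
    (fun a b h => HomSections.ext
      (funext fun V => funext fun hV => congrFun h ⟨V, hV⟩))
    rfl (fun _ _ => rfl) (fun _ => rfl) (fun _ _ => rfl) (fun _ _ => rfl) (fun _ _ => rfl)

instance : SMul (X.presheaf.obj (op U)) (HomSections F G U) :=
  ⟨fun r φ => ⟨fun V h => (X.presheaf.map (homOfLE h).op r) • φ.app V h, by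
    intro V W hWV hVU x
    simp only [LinearMap.smul_apply]
    rw [G.res_smul, φ.naturality, res_res]⟩⟩

@[simp] lemma smul_app (r : X.presheaf.obj (op U)) (φ : HomSections F G U)
    (V : X.Opens) (h : V ≤ U) :
    (r • φ).app V h = (X.presheaf.map (homOfLE h).op r) • φ.app V h := rfl

@[simp] lemma add_app (φ ψ : HomSections F G U) (V : X.Opens) (h : V ≤ U) :
    (φ + ψ).app V h = φ.app V h + ψ.app V h := rfl

@[simp] lemma zero_app (V : X.Opens) (h : V ≤ U) :
    (0 : HomSections F G U).app V h = 0 := rfl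

instance : Module (X.presheaf.obj (op U)) (HomSections F G U) where
  one_smul φ := HomSections.ext (funext fun V => funext fun h => LinearMap.ext fun x => by
    show (X.presheaf.map (homOfLE h).op (1 : X.presheaf.obj (op U))) • φ.app V h x
        = φ.app V h x
    rw [map_one, one_smul])
  mul_smul r s φ := HomSections.ext (funext fun V => funext fun h => LinearMap.ext fun x => by
    show (X.presheaf.map (homOfLE h).op (r * s)) • φ.app V h x
        = (X.presheaf.map (homOfLE h).op r) • (X.presheaf.map (homOfLE h).op s) • φ.app V h x
    rw [map_mul, mul_smul])
  smul_zero r := HomSections.ext (funext fun V => funext fun h => LinearMap.ext fun x => by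
    show (X.presheaf.map (homOfLE h).op r) • (0 : G.obj V) = (0 : G.obj V)
    rw [smul_zero])
  smul_add r φ ψ := HomSections.ext (funext fun V => funext fun h => LinearMap.ext fun x => by
    show (X.presheaf.map (homOfLE h).op r) • (φ.app V h x + ψ.app V h x)
        = (X.presheaf.map (homOfLE h).op r) • φ.app V h x
          + (X.presheaf.map (homOfLE h).op r) • ψ.app V h x
    rw [smul_add])
  add_smul r s φ := HomSections.ext (funext fun V => funext fun h => LinearMap.ext fun x => by
    show (X.presheaf.map (homOfLE h).op (r + s)) • φ.app V h x
        = (X.presheaf.map (homOfLE h).op r) • φ.app V h x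
          + (X.presheaf.map (homOfLE h).op s) • φ.app V h x
    rw [map_add, add_smul])
  zero_smul φ := HomSections.ext (funext fun V => funext fun h => LinearMap.ext fun x => by
    show (X.presheaf.map (homOfLE h).op (0 : X.presheaf.obj (op U))) • φ.app V h x = 0
    rw [map_zero, zero_smul])

end HomSections

/-- The sheaf-Hom `Hom_{O_X}(F, G)` as a presheaf of `O_X`-modules. -/
def homOMod : OModulePresheaf X where
  obj U := HomSections F G U
  instAdd U := inferInstance
  instMod U := inferInstance
  res {U V} h := AddMonoidHom.mk'
    (fun φ => ⟨fun W hW => φ.app W (hW.trans h),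
      fun V' W' hW'V' hV'V x => φ.naturality V' W' hW'V' (hV'V.trans h) x⟩)
    (fun φ ψ => rfl)
  res_id U φ := rfl
  res_comp hWV hVU φ := rfl
  res_smul {U V} h r φ :=
    HomSections.ext (funext fun W => funext fun hW => LinearMap.ext fun x => by
      show (X.presheaf.map (homOfLE (hW.trans h)).op r) • φ.app W (hW.trans h) x
          = (X.presheaf.map (homOfLE hW).op (X.presheaf.map (homOfLE h).op r))
              • φ.app W (hW.trans h) x
      rw [res_res])

/-- The dual `F^∨ = Hom_{O_X}(F, O_X)` of a presheaf of `O_X`-modules. -/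
def dualOMod (F : OModulePresheaf X) : OModulePresheaf X :=
  homOMod F (structureOMod X)

/-- The canonical evaluation map `F(U) → F^∨∨(U)`,
`x ↦ (φ ↦ φ(x|_V))` for `φ ∈ F^∨(V)`, `V ≤ U`. -/
def evalSections (F : OModulePresheaf X) (U : X.Opens) :
    F.obj U → (dualOMod (dualOMod F)).obj U := fun x =>
  { app := fun V hVU =>
      { toFun := fun φ => φ.app V (le_refl V) (F.res hVU x)
        map_add' := fun φ ψ => rfl
        map_smul' := fun r φ => by
          show (X.presheaf.map (homOfLE (le_refl V)).op r)
                • φ.app V (le_refl V) (F.res hVU x)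
              = r • φ.app V (le_refl V) (F.res hVU x)
          have hr : X.presheaf.map (homOfLE (le_refl V)).op r = r := by
            show X.presheaf.map (𝟙 (op V)) r = r
            rw [X.presheaf.map_id]
            rfl
          rw [hr] }
    naturality := fun V W hWV hVU φ => by
      show (structureOMod X).res hWV (φ.app V (le_refl V) (F.res hVU x)) = _
      rw [φ.naturality V W hWV (le_refl V) (F.res hVU x), F.res_comp]
      rfl }

/-- A presheaf of `O_X`-modules is *reflexive* if the canonical morphism to its double
dual is an isomorphism, i.e. bijective on sections over every open. -/
def IsReflexive (F : OModulePresheaf X) : Prop :=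
  ∀ U : X.Opens, Function.Bijective (evalSections F U)

/-- A sheaf of `O_X`-modules on a locally Noetherian scheme is *coherent* iff it is
finitely presented: locally on `X` there is an exact sequence of sheaves
`O_X^m → O_X^n → F → 0` (exactness of sheaves being a local condition on sections). -/
def IsCoherentOMod (F : OModulePresheaf X) : Prop :=
  ∀ x : X, ∃ (U : X.Opens), x ∈ U ∧ ∃ (m n : ℕ)
    (α : HomSections (freeOMod X m) (freeOMod X n) U)
    (β : HomSections (freeOMod X n) F U),
    -- `O_X^n → F` is locally surjective on `U`
    (∀ (V : X.Opens) (hVU : V ≤ U) (s : F.obj V), ∀ y : X, y ∈ V →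
      ∃ (W : X.Opens) (hWV : W ≤ V), y ∈ W ∧
        F.res hWV s ∈ Set.range (β.app W (hWV.trans hVU))) ∧
    -- the kernel of `O_X^n → F` is locally the image of `O_X^m`
    (∀ (V : X.Opens) (hVU : V ≤ U) (v : (freeOMod X n).obj V), β.app V hVU v = 0 →
      ∀ y : X, y ∈ V → ∃ (W : X.Opens) (hWV : W ≤ V), y ∈ W ∧
        (freeOMod X n).res hWV v ∈ Set.range (α.app W (hWV.trans hVU)))

end OModulePresheaf

open OModulePresheaf

section Hartogs

open IsLocalRing

/-- In a Noetherian integrally closed local domain of dimension at least `2`, the maximal ideal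
is not the conductor of any fraction. -/
lemma mem_range_algebraMap_of_forall_mem_maximalIdeal {R K : Type*} [CommRing R] [IsDomain R]
    [IsLocalRing R] [IsNoetherianRing R] [IsIntegrallyClosed R] [Field K] [Algebra R K]
    [IsFractionRing R K] (hdim : 2 ≤ ringKrullDim R) (g : K)
    (hg : ∀ r ∈ maximalIdeal R, g * algebraMap R K r ∈ (algebraMap R K).range) :
    g ∈ (algebraMap R K).range := by
  have not_le_one : ¬ (maximalIdeal R).height ≤ 1 := fun h ↦ by
    rw [← maximalIdeal_height_eq_ringKrullDim] at hdim
    have h2 : (2 : ℕ∞) ≤ (maximalIdeal R).height := WithBot.coe_le_coe.mp hdim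
    exact absurd (h2.trans h) (by decide)
  by_cases hunit : ∃ r ∈ maximalIdeal R, ∃ u, IsUnit u ∧ algebraMap R K u = g * algebraMap R K r
  · obtain ⟨r, hr, u, hu, hgr⟩ := hunit
    refine (not_le_one ?_).elim
    have hspan : maximalIdeal R = Ideal.span {r} := by
      refine le_antisymm (fun m hm ↦ ?_) ((Ideal.span_singleton_le_iff_mem _).mpr hr)
      obtain ⟨k, hk⟩ := hg m hm
      rw [← Ideal.unit_mul_mem_iff_mem _ hu, Ideal.mem_span_singleton]
      refine ⟨k, IsFractionRing.injective R K ?_⟩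
      rw [map_mul, map_mul, hk, hgr]
      ring
    rw [hspan]
    exact Ideal.height_span_singleton_le_one ((mem_maximalIdeal r).mp hr)
  · have hint : IsIntegral R g := by
      refine isIntegral_of_smul_mem_submodule
        (Submodule.map (Algebra.linearMap R K) (maximalIdeal R)) ?_
        ((IsNoetherian.noetherian _).map _) g ?_
      · intro hbot
        replace hbot : maximalIdeal R = ⊥ :=
          Submodule.map_injective_of_injective (f := Algebra.linearMap R K)
            (IsFractionRing.injective R K) (hbot.trans (Submodule.map_bot _).symm)
        exact not_le_one (by simp [hbot])
      · rintro _ ⟨r, hr, rfl⟩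
        obtain ⟨k, hk⟩ := hg r hr
        exact ⟨k, by_contra fun hk' ↦ hunit ⟨r, hr, k, by simpa using hk', hk⟩, hk⟩
    exact IsIntegrallyClosed.algebraMap_eq_of_integral hint

/-- If `f : K` does not lie in the Noetherian ring `R`, some prime `P` is the conductor of a
fraction `g` and contains the conductor of `f`. -/
lemma exists_isPrime_conductor {R K : Type*} [CommRing R] [IsNoetherianRing R] [CommRing K]
    [Algebra R K] (f : K) (hf : f ∉ (algebraMap R K).range) :
    ∃ P : Ideal R, P.IsPrime ∧
      (∃ g : K, ∀ r, r ∈ P ↔ algebraMap R K r * g ∈ (algebraMap R K).range) ∧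
      ∀ r, algebraMap R K r * f ∈ (algebraMap R K).range → r ∈ P := by
  let N : Submodule R K := LinearMap.range (Algebra.linearMap R K)
  have key (x : K) (r : R) : r ∈ (⊥ : Submodule R (K ⧸ N)).colon {N.mkQ x} ↔
      algebraMap R K r * x ∈ (algebraMap R K).range := by
    rw [Submodule.mem_colon_singleton, Submodule.mem_bot, ← map_smul, Submodule.mkQ_apply,
      Submodule.Quotient.mk_eq_zero, Algebra.smul_def]
    rfl
  have hf0 : N.mkQ f ≠ 0 := fun h ↦ hf <| by
    rwa [Submodule.mkQ_apply, Submodule.Quotient.mk_eq_zero] at h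
  obtain ⟨P, hP, hle⟩ := exists_le_isAssociatedPrime_of_isNoetherianRing R (N.mkQ f) hf0
  obtain ⟨hprime, y, rfl⟩ := isAssociatedPrime_iff.mp hP
  obtain ⟨g, rfl⟩ := N.mkQ_surjective y
  exact ⟨_, hprime, ⟨g, key g⟩, fun r hr ↦ hle ((key f r).mpr hr)⟩

/-- A rational function on an affine open of a normal locally Noetherian integral scheme is
regular as soon as it is regular at the points of codimension at most `1`. -/
lemma mem_range_algebraMap_of_isAffineOpen (X : Scheme.{u}) [IsIntegral X] [IsLocallyNoetherian X]
    (hnormal : ∀ x : X, IsIntegrallyClosed (X.presheaf.stalk x))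
    (U₀ : X.Opens) (hcodim : ∀ x : X, x ∉ U₀ → 2 ≤ ringKrullDim (X.presheaf.stalk x))
    (V : X.Opens) (hV : IsAffineOpen V) [Nonempty V] (f : X.functionField)
    (hf : ∀ y ∈ V, y ∈ U₀ → f ∈ (algebraMap (X.presheaf.stalk y) X.functionField).range) :
    f ∈ (algebraMap Γ(X, V) X.functionField).range := by
  by_contra hfV
  have : IsNoetherianRing Γ(X, V) := IsLocallyNoetherian.component_noetherian ⟨V, hV⟩
  obtain ⟨P, hP, ⟨g, hg⟩, hfP⟩ := exists_isPrime_conductor f hfV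
  obtain ⟨y, hy⟩ : ∃ y : V, (hV.primeIdealOf y).asIdeal = P :=
    ⟨hV.isoSpec.inv ⟨P, hP⟩, by
      have h (z : Spec Γ(X, V)) : hV.isoSpec.hom (hV.isoSpec.inv z) = z := by
        rw [← Scheme.Hom.comp_apply, Iso.inv_hom_id]
        rfl
      exact congrArg PrimeSpectrum.asIdeal (h ⟨P, hP⟩)⟩
  let := TopCat.Presheaf.algebra_section_stalk X.presheaf y
  have hloc : IsLocalization.AtPrime (X.presheaf.stalk y.1) P := by
    subst hy
    exact hV.isLocalization_stalk y
  have := functionField_isScalarTower X V y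
  have := hnormal y
  have clear_denom (x : X.functionField)
      (hx : x ∈ (algebraMap (X.presheaf.stalk y.1) X.functionField).range) :
      ∃ s ∉ P, algebraMap Γ(X, V) X.functionField s * x ∈
        (algebraMap Γ(X, V) X.functionField).range := by
    obtain ⟨z, rfl⟩ := hx
    obtain ⟨⟨a, s⟩, hz⟩ := IsLocalization.surj P.primeCompl z
    refine ⟨s, s.2, a, ?_⟩
    rw [IsScalarTower.algebraMap_apply Γ(X, V) (X.presheaf.stalk y.1),
      IsScalarTower.algebraMap_apply Γ(X, V) (X.presheaf.stalk y.1) _ (s : Γ(X, V)), ← hz,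
      map_mul, mul_comm]
  by_cases hyU : y.1 ∈ U₀
  · obtain ⟨s, hs, h⟩ := clear_denom f (hf y y.2 hyU)
    exact hs (hfP s h)
  · have hgy : g ∈ (algebraMap (X.presheaf.stalk y.1) X.functionField).range := by
      refine mem_range_algebraMap_of_forall_mem_maximalIdeal (hcodim y hyU) g fun r hr ↦ ?_
      obtain ⟨⟨a, s⟩, rfl⟩ := IsLocalization.mk'_surjective P.primeCompl r
      have ha : a ∈ P := (IsLocalization.AtPrime.mk'_mem_maximal_iff _ P a s).mp hr
      obtain ⟨b, hb⟩ := (hg a).mp ha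
      refine ⟨IsLocalization.mk' _ b s, ?_⟩
      have hs : algebraMap Γ(X, V) X.functionField s ≠ 0 := by
        intro h0
        refine s.2 ((hg s).mpr ?_)
        rw [h0, zero_mul]
        exact zero_mem _
      have hmk (c : Γ(X, V)) : algebraMap (X.presheaf.stalk y.1) X.functionField
          (IsLocalization.mk' _ c s) * algebraMap Γ(X, V) X.functionField s =
            algebraMap Γ(X, V) X.functionField c := by
        rw [IsScalarTower.algebraMap_apply Γ(X, V) (X.presheaf.stalk y.1), ← map_mul,
          IsLocalization.mk'_spec, ← IsScalarTower.algebraMap_apply]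
      refine mul_right_cancel₀ hs ?_
      rw [hmk, mul_assoc, hmk, hb, mul_comm]
    obtain ⟨s, hs, h⟩ := clear_denom g hgy
    exact hs ((hg s).mpr h)

/-- Algebraic Hartogs: regular functions on a normal locally Noetherian integral scheme extend
uniquely over closed subsets of codimension at least `2`. -/
lemma structureOMod_res_bijective (X : Scheme.{u}) [IsIntegral X] [IsLocallyNoetherian X]
    (hnormal : ∀ x : X, IsIntegrallyClosed (X.presheaf.stalk x))
    (U₀ : X.Opens) (hcodim : ∀ x : X, x ∉ U₀ → 2 ≤ ringKrullDim (X.presheaf.stalk x))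
    (W : X.Opens) :
    Function.Bijective ((structureOMod X).res (inf_le_left : W ⊓ U₀ ≤ W)) := by
  have hη : genericPoint X ∈ U₀ := by
    by_contra h
    have h2 := hcodim _ h
    rw [show ringKrullDim (X.presheaf.stalk (genericPoint X)) = 0 from
      ringKrullDim_eq_zero_of_field X.functionField] at h2
    exact absurd h2 (by decide)
  have hgen (V : X.Opens) [h : Nonempty V] : genericPoint X ∈ V :=
    ((genericPoint_spec X).mem_open_set_iff V.isOpen).mpr (by simpa using h)
  change Function.Bijective (X.presheaf.map (homOfLE (inf_le_left : W ⊓ U₀ ≤ W)).op)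
  rcases isEmpty_or_nonempty W with hW | hW
  · obtain rfl : W = ⊥ := by
      ext x
      simpa using fun hx ↦ hW.false ⟨x, hx⟩
    have e : (⊥ : X.Opens) ⊓ U₀ = ⊥ := bot_inf_eq _
    have : Subsingleton Γ(X, (⊥ : X.Opens) ⊓ U₀) := by rw [e]; infer_instance
    exact ⟨fun _ _ _ ↦ Subsingleton.elim (α := Γ(X, ⊥)) _ _,
      fun _ ↦ ⟨0, Subsingleton.elim (α := Γ(X, ⊥ ⊓ U₀)) _ _⟩⟩
  have : Nonempty (W ⊓ U₀ : X.Opens) := ⟨⟨genericPoint X, hgen W, hη⟩⟩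
  refine ⟨map_injective_of_isIntegral X _, fun s ↦ ?_⟩
  let f : X.functionField := X.germToFunctionField (W ⊓ U₀) s
  have hf (V : X.Opens) (hV : V ∈ {V : X.Opens | IsAffineOpen V ∧ V ≤ W ∧ Nonempty V}) :
      ∃ t : Γ(X, V), X.presheaf.germ V (genericPoint X) (have := hV.2.2; hgen V) t = f := by
    obtain ⟨hVa, hVW, hVne⟩ := hV
    exact mem_range_algebraMap_of_isAffineOpen X hnormal U₀ hcodim V hVa f fun y hyV hyU ↦
      ⟨X.presheaf.germ (W ⊓ U₀) y ⟨hVW hyV, hyU⟩ s,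
        Scheme.algebraMap_germ_eq_germToFunctionField X _ s⟩
  choose t ht using hf
  obtain ⟨r, hr, -⟩ := X.sheaf.existsUnique_gluing'
    (fun V : {V : X.Opens | IsAffineOpen V ∧ V ≤ W ∧ Nonempty V} ↦ V.1) W
    (fun V ↦ homOfLE V.2.2.1) (fun x hx ↦ by
      obtain ⟨_, ⟨V, hV, rfl⟩, hxV, hVW⟩ :=
        X.isBasis_affineOpens.exists_subset_of_mem_open hx W.isOpen
      exact TopologicalSpace.Opens.mem_iSup.mpr ⟨⟨V, hV, hVW, ⟨⟨x, hxV⟩⟩⟩, hxV⟩)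
    (fun V ↦ t V.1 V.2) (fun V V' ↦ by
      have := V.2.2.2
      have := V'.2.2.2
      refine germ_injective_of_isIntegral X (genericPoint X) (U := V.1 ⊓ V'.1)
        ⟨hgen V.1, hgen V'.1⟩ ?_
      exact (X.presheaf.germ_res_apply _ _ _ _).trans
        (((ht V.1 V.2).trans (ht V'.1 V'.2).symm).trans (X.presheaf.germ_res_apply _ _ _ _).symm))
  refine ⟨r, germ_injective_of_isIntegral X (genericPoint X) (hgen (W ⊓ U₀)) ?_⟩
  obtain ⟨_, ⟨V, hV, rfl⟩, hxV, hVW⟩ :=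
    X.isBasis_affineOpens.exists_subset_of_mem_open (hgen W) W.isOpen
  have hV' : V ∈ {V : X.Opens | IsAffineOpen V ∧ V ≤ W ∧ Nonempty V} :=
    ⟨hV, hVW, ⟨⟨_, hxV⟩⟩⟩
  refine Eq.trans ?_ (ht V hV')
  rw [← hr ⟨V, hV'⟩]
  exact (X.presheaf.germ_res_apply _ _ _ _).trans (X.presheaf.germ_res_apply _ _ _ _).symm

end Hartogs

namespace OModulePresheaf

variable {X : Scheme.{u}}

/-- Sections of `Hom(G, H)` extend uniquely from `V ⊓ U₀` to `V` if sections of `H` do so over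
every open set. -/
lemma homOMod_res_bijective (G H : OModulePresheaf X) (U₀ : X.Opens)
    (hH : ∀ W : X.Opens, Function.Bijective (H.res (inf_le_left : W ⊓ U₀ ≤ W))) (V : X.Opens) :
    Function.Bijective ((homOMod G H).res (inf_le_left : V ⊓ U₀ ≤ V)) := by
  constructor
  · intro φ ψ h
    refine HomSections.ext (funext fun W ↦ funext fun hW ↦ LinearMap.ext fun x ↦ (hH W).1 ?_)
    rw [φ.naturality, ψ.naturality]
    exact congrArg (fun χ : HomSections G H (V ⊓ U₀) ↦
      χ.app (W ⊓ U₀) (inf_le_inf_right _ hW) (G.res inf_le_left x)) h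
  · intro φ
    change HomSections G H (V ⊓ U₀) at φ
    choose e he using fun W ↦ (hH W).2
    let ψ : HomSections G H V :=
      { app := fun W hW ↦
          { toFun := fun x ↦ e W (HomSections.app φ (W ⊓ U₀) (inf_le_inf_right _ hW)
              (G.res inf_le_left x))
            map_add' := fun x y ↦ (hH W).1 <| by simp only [map_add, he]
            map_smul' := fun r x ↦ (hH W).1 <| by
              simp only [RingHom.id_apply, H.res_smul, G.res_smul, he, map_smul] }
        naturality := fun W W' hW' hW x ↦ (hH W').1 <| by
          simp only [LinearMap.coe_mk, AddHom.coe_mk, he]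
          rw [H.res_comp, ← H.res_comp (inf_le_inf_right U₀ hW') inf_le_left, he,
            HomSections.naturality, G.res_comp, G.res_comp] }
    refine ⟨ψ, HomSections.ext (funext fun W ↦ funext fun hW ↦ LinearMap.ext fun x ↦
      (hH W).1 ?_)⟩
    exact (he W _).trans (HomSections.naturality φ W (W ⊓ U₀) inf_le_left hW x).symm

lemma evalSections_res (F : OModulePresheaf X) {U V : X.Opens} (h : V ≤ U) (x : F.obj U) :
    evalSections F V (F.res h x) = (dualOMod (dualOMod F)).res h (evalSections F U x) := by
  refine HomSections.ext (funext fun W ↦ funext fun hW ↦ LinearMap.ext fun φ ↦ ?_)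
  exact congrArg (HomSections.app φ W le_rfl) (F.res_comp hW h x)

end OModulePresheaf

theorem reflexive_coherent_extends_over_codim_two
    (X : Scheme.{u}) [IsIntegral X] [IsLocallyNoetherian X]
    -- `X` is normal: every local ring of `X` is integrally closed
    (hnormal : ∀ x : X, IsIntegrallyClosed (X.presheaf.stalk x))
    -- `U₀ ⊆ X` open, whose closed complement has codimension at least 2: every point
    -- outside `U₀` has local ring of Krull dimension at least 2
    (U₀ : X.Opens)
    (hcodim : ∀ x : X, x ∉ U₀ → 2 ≤ ringKrullDim (X.presheaf.stalk x))
    -- `F` a reflexive coherent sheaf of `O_X`-modules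
    (F : OModulePresheaf X) (hsheaf : IsSheafOfOModules F)
    (hcoherent : IsCoherentOMod F) (hreflexive : IsReflexive F) :
    -- the adjunction unit `F → i_* i^* F`, whose component over an open `V` is the
    -- restriction `F(V) → F(V ⊓ U₀)`, is an isomorphism of sheaves of `O_X`-modules
    ∀ V : X.Opens, Function.Bijective (F.res (inf_le_left : V ⊓ U₀ ≤ V)) := by
  intro V
  have hbij := homOMod_res_bijective (dualOMod F) (structureOMod X) U₀
    (structureOMod_res_bijective X hnormal U₀ hcodim) V
  rw [← Function.Bijective.of_comp_iff' (hreflexive (V ⊓ U₀))]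
  have hcomp : evalSections F (V ⊓ U₀) ∘ F.res inf_le_left =
      (dualOMod (dualOMod F)).res inf_le_left ∘ evalSections F V :=
    funext (evalSections_res F inf_le_left)
  rw [hcomp]
  exact hbij.comp (hreflexive V)
end

section
/- Let k be a perfect field of characteristic p > 0 and let W₂(k) denote the ring of Witt vectors of length 2 over k. Then there exists no polynomial f ∈ W₂(k)[x] such that the identity (x+y)^p + p·f(x+y) = x^p + y^p + p·f(x) + p·f(y) holds in the polynomial ring W₂(k)[x,y]. (Consequently, the Frobenius endomorphism of the additive group scheme 𝔾_a over k does not lift to a group scheme endomorphism of 𝔾_a over W₂(k).) -/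
/-!
STATEMENT 6: For a perfect field `k` of characteristic `p` and the ring `W₂(k)` of
Witt vectors of length 2 over `k`, there is no polynomial `f ∈ W₂(k)[x]` with
`(x+y)^p + p·f(x+y) = x^p + y^p + p·f(x) + p·f(y)` in `W₂(k)[x,y]`
(so the Frobenius of `𝔾ₐ` over `k` does not lift to a group scheme endomorphism of
`𝔾ₐ` over `W₂(k)`).  The two-variable polynomial ring `W₂(k)[x,y]` is realized as
`MvPolynomial (Fin 2) (TruncatedWittVector p 2 k)` with `x = X 0`, `y = X 1`, and the
substitutions `f(x+y)`, `f(x)`, `f(y)` as `Polynomial.aeval`.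
-/

open MvPolynomial

/-- Differentiating the additivity identity in `y` at `y = 0` and comparing coefficients of
`x ^ (p - 1)` shows that `p = 0` in any ring where `p ^ 2 = 0`. -/
theorem natCast_eq_zero_of_additive_lift {R : Type*} [CommRing R] {p : ℕ} (hp : 2 ≤ p)
    (hp2 : (p : R) ^ 2 = 0) (f : Polynomial R)
    (h : (X 0 + X 1 : MvPolynomial (Fin 2) R) ^ p
          + (p : MvPolynomial (Fin 2) R)
            * Polynomial.aeval (X 0 + X 1 : MvPolynomial (Fin 2) R) f
        = (X 0 : MvPolynomial (Fin 2) R) ^ p + (X 1 : MvPolynomial (Fin 2) R) ^ p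
          + (p : MvPolynomial (Fin 2) R) * Polynomial.aeval (X 0 : MvPolynomial (Fin 2) R) f
          + (p : MvPolynomial (Fin 2) R) * Polynomial.aeval (X 1 : MvPolynomial (Fin 2) R) f) :
    (p : R) = 0 := by
  have hd := congrArg (aeval ![(Polynomial.X : Polynomial R), 0])
    (congrArg (pderiv (1 : Fin 2)) h)
  simp only [map_add, Derivation.leibniz, Derivation.leibniz_pow, Derivation.map_natCast,
    Derivation.map_aeval, pderiv_X_self, pderiv_X_of_ne (zero_ne_one : (0 : Fin 2) ≠ 1),
    smul_eq_mul, nsmul_eq_mul, map_mul, map_pow, map_natCast, aeval_X,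
    ← Polynomial.aeval_algHom_apply, Matrix.cons_val_zero, Matrix.cons_val_one,
    add_zero, zero_add, mul_zero, mul_one, Polynomial.aeval_X_left_apply,
    zero_pow (show p - 1 ≠ 0 by omega)] at hd
  have hc := congrArg (Polynomial.coeff · (p - 1)) hd
  have hzero : Polynomial.aeval (0 : Polynomial R) (Polynomial.derivative f)
      = Polynomial.C ((Polynomial.derivative f).coeff 0) := by
    rw [← map_zero (algebraMap R (Polynomial R)), Polynomial.aeval_algebraMap_apply,
      Polynomial.coeff_zero_eq_aeval_zero, Polynomial.algebraMap_eq]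
  have hcast : ((p - 1 : ℕ) : R) + 1 = p := by
    exact_mod_cast congrArg (Nat.cast : ℕ → R) (Nat.sub_add_cancel (by omega : 1 ≤ p))
  simp only [hzero, Polynomial.coeff_add, Polynomial.coeff_natCast_mul,
    Polynomial.coeff_X_pow_self, Polynomial.coeff_derivative, hcast,
    Polynomial.coeff_C_of_ne_zero (show p - 1 ≠ 0 by omega), mul_one, mul_zero] at hc
  linear_combination hc - f.coeff (p - 1 + 1) * hp2

theorem TruncatedWittVector.natCast_sq_eq_zero (p : ℕ) [Fact p.Prime] (k : Type*) [CommRing k]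
    [CharP k p] : (p : TruncatedWittVector p 2 k) ^ 2 = 0 := by
  rw [← map_natCast (WittVector.truncate 2 : WittVector p k →+* _), ← map_pow,
    ← RingHom.mem_ker, WittVector.mem_ker_truncate]
  exact fun i hi => WittVector.coeff_p_pow_eq_zero p k hi.ne

theorem TruncatedWittVector.natCast_ne_zero (p : ℕ) [Fact p.Prime] (k : Type*) [CommRing k]
    [Nontrivial k] [CharP k p] : (p : TruncatedWittVector p 2 k) ≠ 0 := by
  rw [← map_natCast (WittVector.truncate 2 : WittVector p k →+* _), Ne,
    ← RingHom.mem_ker, WittVector.mem_ker_truncate]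
  intro h
  simpa [WittVector.coeff_p_one] using h 1 one_lt_two

theorem no_additive_frobenius_lift_of_Ga_over_W2
    (p : ℕ) [Fact p.Prime] (k : Type) [Field k] [CharP k p] [PerfectField k] :
    ¬ ∃ f : Polynomial (TruncatedWittVector p 2 k),
        (X 0 + X 1 : MvPolynomial (Fin 2) (TruncatedWittVector p 2 k)) ^ p
            + (p : MvPolynomial (Fin 2) (TruncatedWittVector p 2 k))
              * Polynomial.aeval (X 0 + X 1 : MvPolynomial (Fin 2) (TruncatedWittVector p 2 k)) f
          = (X 0 : MvPolynomial (Fin 2) (TruncatedWittVector p 2 k)) ^ p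
            + (X 1 : MvPolynomial (Fin 2) (TruncatedWittVector p 2 k)) ^ p
            + (p : MvPolynomial (Fin 2) (TruncatedWittVector p 2 k))
              * Polynomial.aeval (X 0 : MvPolynomial (Fin 2) (TruncatedWittVector p 2 k)) f
            + (p : MvPolynomial (Fin 2) (TruncatedWittVector p 2 k))
              * Polynomial.aeval (X 1 : MvPolynomial (Fin 2) (TruncatedWittVector p 2 k)) f := by
  rintro ⟨f, hf⟩
  exact TruncatedWittVector.natCast_ne_zero p k
    (natCast_eq_zero_of_additive_lift (Fact.out : p.Prime).two_le
      (TruncatedWittVector.natCast_sq_eq_zero p k) f hf)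
end
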